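/- Let s and t be coprime positive integers, m = ⌊s/2⌋, n = ⌊t/2⌋, and A_{i,j} = st − (2j−1)s − (2i−1)t. Then Σ_ν Σ_{(i,j)∈ν} A_{i,j} = (st+s+t) · C(m+n, m) · mn/2 − 2s · C(n+2, 3) · C(m+n, n+1) − 2t · C(m+2, 3) · C(m+n, m+1), where ν ranges over all partitions fitting in the m×n box and (i,j) ranges over the cells of ν. -/

import Mathlib

/-- A partition, given by its (0-indexed) weakly decreasing sequence of parts,
which is eventually zero. Row `i` of the Young diagram has `parts i` cells;
the diagram consists of the (0-indexed) cells `(i, j)` with `j < parts i`. -/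
structure YPartition where
  parts : ℕ → ℕ
  antitone : ∀ ⦃i j : ℕ⦄, i ≤ j → parts j ≤ parts i
  finite_support : ∃ N, ∀ i, N ≤ i → parts i = 0

namespace YPartition

/-- The `j`-th (0-indexed) part of the conjugate partition: the number of rows
whose length exceeds `j`. -/
noncomputable def conj (p : YPartition) (j : ℕ) : ℕ := Set.ncard {i : ℕ | j < p.parts i}

/-- The set of (0-indexed) cells of the Young diagram. -/
def cells (p : YPartition) : Set (ℕ × ℕ) := {c | c.2 < p.parts c.1}

/-- The size of a partition: the number of cells of its Young diagram. -/
noncomputable def size (p : YPartition) : ℕ := p.cells.ncard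

/-- The hook length of the (0-indexed) cell `(i, j)`:
`λ_i − j + λ'_j − i + 1` in 1-indexed terms. -/
noncomputable def hook (p : YPartition) (i j : ℕ) : ℕ := p.parts i + p.conj j - i - j - 1

/-- A partition is self-conjugate if it equals its conjugate. -/
def SelfConj (p : YPartition) : Prop := ∀ j, p.conj j = p.parts j

/-- A partition is a `t`-core if no cell of its diagram has hook length `t`. -/
def IsCore (t : ℕ) (p : YPartition) : Prop :=
  ∀ i j : ℕ, (i, j) ∈ p.cells → p.hook i j ≠ t

/-- The set of hook lengths of the main diagonal cells. -/
def MD (p : YPartition) : Set ℕ := {h | ∃ i : ℕ, i < p.parts i ∧ h = p.hook i i}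

end YPartition

/-- The Ford–Mai–Sze array entry `A_{i,j} = st − (2j−1)s − (2i−1)t` (1-indexed). -/
def fmsA (s t i j : ℕ) : ℤ :=
  (s : ℤ) * t - (2 * (j : ℤ) - 1) * s - (2 * (i : ℤ) - 1) * t

/-- Partitions fitting in the `m × n` box: at most `m` parts, each of size at most `n`. -/
def boxSet (m n : ℕ) : Set YPartition := {ν | ν.parts 0 ≤ n ∧ ν.parts m = 0}

/-- Add a new first row of length `k`. -/
def YPartition.consRow (k : ℕ) (p : YPartition) (h : p.parts 0 ≤ k) : YPartition where
  parts := fun i => if i = 0 then k else p.parts (i - 1)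
  antitone := by
    intro i j hij
    by_cases hi : i = 0
    · by_cases hj : j = 0
      · simp [hi, hj]
      · simp only [hi, hj, if_true, if_false]
        exact (p.antitone (Nat.zero_le _)).trans h
    · have hj : j ≠ 0 := by omega
      simp only [hi, hj, if_false]
      exact p.antitone (by omega)
  finite_support := by
    obtain ⟨N, hN⟩ := p.finite_support
    refine ⟨N + 1, fun i hi => ?_⟩
    have h0 : i ≠ 0 := by omega
    simp only [h0, if_false]
    exact hN _ (by omega)

/-- Total version of `consRow`. -/
noncomputable def YPartition.cons (k : ℕ) (p : YPartition) : YPartition :=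
  open Classical in if h : p.parts 0 ≤ k then p.consRow k h else p

theorem YPartition.ext_parts {p q : YPartition} (h : ∀ i, p.parts i = q.parts i) : p = q := by
  cases p; cases q
  congr
  exact funext h

theorem YPartition.cons_zero {k : ℕ} {p : YPartition} (h : p.parts 0 ≤ k) :
    (p.cons k).parts 0 = k := by
  simp [YPartition.cons, h, YPartition.consRow]

theorem YPartition.cons_succ {k : ℕ} {p : YPartition} (h : p.parts 0 ≤ k) (i : ℕ) :
    (p.cons k).parts (i + 1) = p.parts i := by
  simp [YPartition.cons, h, YPartition.consRow]

/-- The tail of a partition. -/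
def YPartition.tail (p : YPartition) : YPartition where
  parts := fun i => p.parts (i + 1)
  antitone := fun i j hij => p.antitone (by omega)
  finite_support := by
    obtain ⟨N, hN⟩ := p.finite_support
    exact ⟨N, fun i hi => hN _ (by omega)⟩

/-- The empty partition. -/
def YPartition.empty : YPartition where
  parts := fun _ => 0
  antitone := fun _ _ _ => le_rfl
  finite_support := ⟨0, fun _ _ => rfl⟩

theorem boxSet_zero_left (n : ℕ) : boxSet 0 n = {YPartition.empty} := by
  ext p
  simp only [boxSet, Set.mem_setOf_eq, Set.mem_singleton_iff]
  constructor
  · rintro ⟨_, h⟩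
    apply YPartition.ext_parts
    intro i
    have := p.antitone (Nat.zero_le i)
    simp only [YPartition.empty]
    omega
  · rintro rfl
    simp [YPartition.empty]

theorem boxSet_zero_right (m : ℕ) : boxSet m 0 = {YPartition.empty} := by
  ext p
  simp only [boxSet, Set.mem_setOf_eq, Set.mem_singleton_iff]
  constructor
  · rintro ⟨h, _⟩
    apply YPartition.ext_parts
    intro i
    have := p.antitone (Nat.zero_le i)
    simp only [YPartition.empty]
    omega
  · rintro rfl
    simp [YPartition.empty]

theorem boxSet_succ (m n : ℕ) : boxSet (m + 1) (n + 1) =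
    boxSet (m + 1) n ∪ (YPartition.cons (n + 1)) '' boxSet m (n + 1) := by
  ext p
  simp only [Set.mem_union, Set.mem_image]
  constructor
  · rintro ⟨h1, h2⟩
    by_cases h : p.parts 0 ≤ n
    · exact Or.inl ⟨h, h2⟩
    · right
      have h0 : p.tail.parts 0 ≤ n + 1 := (p.antitone (Nat.zero_le 1)).trans h1
      refine ⟨p.tail, ⟨h0, h2⟩, ?_⟩
      apply YPartition.ext_parts
      intro i
      cases i with
      | zero => rw [YPartition.cons_zero h0]; omega
      | succ i => rw [YPartition.cons_succ h0]; rfl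
  · rintro (⟨h1, h2⟩ | ⟨q, ⟨h1, h2⟩, rfl⟩)
    · exact ⟨by omega, h2⟩
    · exact ⟨(YPartition.cons_zero h1).le, by rw [YPartition.cons_succ h1]; exact h2⟩

theorem boxSet_disj (m n : ℕ) :
    Disjoint (boxSet (m + 1) n) ((YPartition.cons (n + 1)) '' boxSet m (n + 1)) := by
  rw [Set.disjoint_left]
  rintro p ⟨h1, _⟩ ⟨q, ⟨h2, _⟩, rfl⟩
  rw [YPartition.cons_zero h2] at h1
  omega

theorem cons_injOn (m n : ℕ) : Set.InjOn (YPartition.cons n) (boxSet m n) := by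
  rintro p ⟨hp, _⟩ q ⟨hq, _⟩ h
  apply YPartition.ext_parts
  intro i
  rw [← YPartition.cons_succ hp, h, YPartition.cons_succ hq]

theorem boxSet_finite (m n : ℕ) : (boxSet m n).Finite := by
  induction m generalizing n with
  | zero => rw [boxSet_zero_left]; exact Set.finite_singleton _
  | succ m ihm =>
    induction n with
    | zero => rw [boxSet_zero_right]; exact Set.finite_singleton _
    | succ n ihn =>
      rw [boxSet_succ]
      exact ihn.union ((ihm _).image _)

theorem finsum_boxSet_succ (m n : ℕ) (f : YPartition → ℤ) :
    ∑ᶠ ν ∈ boxSet (m + 1) (n + 1), f ν = ∑ᶠ ν ∈ boxSet (m + 1) n, f ν +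
      ∑ᶠ ν ∈ boxSet m (n + 1), f (ν.cons (n + 1)) := by
  rw [boxSet_succ, finsum_mem_union (boxSet_disj m n) (boxSet_finite _ _)
    ((boxSet_finite _ _).image _), finsum_mem_image (cons_injOn _ _)]

theorem box_count (m n : ℕ) (c : ℤ) :
    ∑ᶠ ν ∈ boxSet m n, c = c * ((m + n).choose m : ℤ) := by
  induction m generalizing n with
  | zero => rw [boxSet_zero_left, finsum_mem_singleton]; simp
  | succ m ihm =>
    induction n with
    | zero => rw [boxSet_zero_right, finsum_mem_singleton]; simp
    | succ n ihn =>
      rw [finsum_boxSet_succ m n (fun _ => c), ihn, ihm]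
      have : (m + 1 + (n + 1)).choose (m + 1)
          = (m + (n + 1)).choose m + (m + 1 + n).choose (m + 1) := by
        rw [show m + 1 + (n + 1) = (m + 1 + n) + 1 by ring, Nat.choose_succ_succ,
          show m + (n + 1) = m + 1 + n by ring]
      rw [this]; push_cast; ring

/-- The linear statistic of the cells of a partition. -/
noncomputable def boxStat (m : ℕ) (a b c : ℤ) (ν : YPartition) : ℤ :=
  ∑ i ∈ Finset.Icc 1 m, ∑ j ∈ Finset.Icc 1 (ν.parts (i - 1)), (a + b * (i : ℤ) + c * (j : ℤ))

theorem two_row_sum (k : ℕ) (a c : ℤ) :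
    2 * ∑ j ∈ Finset.Icc 1 k, (a + c * (j : ℤ)) = 2 * a * k + c * k * (k + 1) := by
  induction k with
  | zero => simp
  | succ k ih =>
    rw [Finset.sum_Icc_succ_top (by omega), mul_add, ih]; push_cast; ring

theorem boxStat_cons (m k : ℕ) (a b c : ℤ) (ν : YPartition) (h : ν.parts 0 ≤ k) :
    boxStat (m + 1) a b c (ν.cons k) =
      ∑ j ∈ Finset.Icc 1 k, ((a + b) + c * (j : ℤ)) + boxStat m (a + b) b c ν := by
  unfold boxStat
  simp only [← Finset.Ico_add_one_right_eq_Icc 1 m, ← Finset.Ico_add_one_right_eq_Icc 1 (m + 1)]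
  rw [Finset.sum_Ico_eq_sum_range, Finset.sum_Ico_eq_sum_range]
  simp only [Nat.add_sub_cancel]
  rw [Finset.sum_range_succ', add_comm]
  congr 1
  · simp [YPartition.cons_zero h]
  · refine Finset.sum_congr rfl fun i _ => ?_
    rw [show 1 + (i + 1) - 1 = i + 1 by omega, show 1 + i - 1 = i by omega,
      YPartition.cons_succ h]
    refine Finset.sum_congr rfl fun j _ => ?_
    push_cast; ring

theorem choose_rel (m n : ℕ) :
    ((m : ℤ) + 1) * ((m + 1 + n).choose (m + 1) : ℤ)
      = ((n : ℤ) + 1) * ((m + (n + 1)).choose m : ℤ) := by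
  have := Nat.choose_succ_right_eq (m + 1 + n) m
  rw [show m + 1 + n - m = n + 1 by omega] at this
  rw [show m + (n + 1) = m + 1 + n by ring]
  have h2 : (((m + 1 + n).choose (m + 1) : ℤ)) * ((m : ℤ) + 1)
    = ((m + 1 + n).choose m : ℤ) * ((n : ℤ) + 1) := by exact_mod_cast this
  linarith

theorem box_main (m n : ℕ) (a b c : ℤ) :
    6 * ∑ᶠ ν ∈ boxSet m n, boxStat m a b c ν =
      ((m + n).choose m : ℤ) * m * n * (3 * a + b * (m + 2) + c * (n + 2)) := by
  induction m generalizing n a with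
  | zero => rw [boxSet_zero_left, finsum_mem_singleton]; simp [boxStat]
  | succ m ihm =>
    induction n with
    | zero => rw [boxSet_zero_right, finsum_mem_singleton]; simp [boxStat, YPartition.empty]
    | succ n ihn =>
      rw [finsum_boxSet_succ]
      have e : ∑ᶠ ν ∈ boxSet m (n + 1), boxStat (m + 1) a b c (ν.cons (n + 1)) =
          ∑ᶠ ν ∈ boxSet m (n + 1), (∑ j ∈ Finset.Icc 1 (n + 1), ((a + b) + c * (j : ℤ))
            + boxStat m (a + b) b c ν) :=
        finsum_mem_congr rfl fun ν hν => boxStat_cons _ _ _ _ _ _ hν.1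
      rw [e, finsum_mem_add_distrib (boxSet_finite _ _), box_count]
      have h1 := ihm (n + 1) (a + b)
      have h2 := two_row_sum (n + 1) (a + b) c
      have h3 := choose_rel m n
      have h4 : (m + 1 + (n + 1)).choose (m + 1)
          = (m + (n + 1)).choose m + (m + 1 + n).choose (m + 1) := by
        rw [show m + 1 + (n + 1) = (m + 1 + n) + 1 by ring, Nat.choose_succ_succ,
          show m + (n + 1) = m + 1 + n by ring]
      rw [h4]
      push_cast at *
      linear_combination ihn + h1 + 3 * ((m + (n + 1)).choose m : ℤ) * h2
        - (3 * a + b * (m + 3) + c * (2 * n + 3)) * h3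

theorem choose_three (m : ℕ) :
    6 * ((m + 2).choose 3 : ℤ) = (m + 2) * (m + 1) * m := by
  induction m with
  | zero => simp
  | succ m ih =>
    have h2 : 2 * ((m + 2).choose 2 : ℤ) = (m + 2) * (m + 1) := by
      have := Nat.triangle_succ (m + 1)
      have h := Nat.choose_succ_right_eq (m + 2) 1
      simp at h
      have h' : (((m + 2).choose 2 : ℤ)) * 2 = (m + 2) * (m + 1) := by exact_mod_cast h
      linarith
    rw [show m + 1 + 2 = (m + 2) + 1 by ring, Nat.choose_succ_succ]
    push_cast
    linear_combination ih + 3 * h2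

theorem choose_prod (m n : ℕ) :
    6 * ((m + 2).choose 3 : ℤ) * ((m + n).choose (m + 1) : ℤ)
      = ((m + n).choose m : ℤ) * m * n * (m + 2) := by
  have h := Nat.choose_succ_right_eq (m + n) m
  rw [show m + n - m = n by omega] at h
  have h' : (((m + n).choose (m + 1) : ℤ)) * (m + 1) = ((m + n).choose m : ℤ) * n := by
    exact_mod_cast h
  linear_combination ((m + n).choose (m + 1) : ℤ) * choose_three m + (m + 2) * m * h'

open YPartition in
/-- With `m = ⌊s/2⌋`, `n = ⌊t/2⌋`:
`Σ_ν Σ_{(i,j)∈ν} A_{i,j} = (st+s+t)·C(m+n,m)·mn/2 − 2s·C(n+2,3)·C(m+n,n+1)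
− 2t·C(m+2,3)·C(m+n,m+1)` (stated multiplied through by `2`), the outer sum over
partitions `ν` in the `m × n` box and the inner sum over (1-indexed) cells of `ν`. -/
theorem sum_A_over_box (s t : ℕ) (hs : 0 < s) (ht : 0 < t) (hst : Nat.Coprime s t) :
    (boxSet (s / 2) (t / 2)).Finite ∧
    2 * (∑ᶠ ν ∈ boxSet (s / 2) (t / 2),
          ∑ i ∈ Finset.Icc 1 (s / 2), ∑ j ∈ Finset.Icc 1 (ν.parts (i - 1)), fmsA s t i j)
      = ((s : ℤ) * t + s + t) * Nat.choose (s / 2 + t / 2) (s / 2) * ((s / 2 : ℕ) * (t / 2 : ℕ))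
        - 4 * s * Nat.choose (t / 2 + 2) 3 * Nat.choose (s / 2 + t / 2) (t / 2 + 1)
        - 4 * t * Nat.choose (s / 2 + 2) 3 * Nat.choose (s / 2 + t / 2) (s / 2 + 1) := by
  refine ⟨boxSet_finite _ _, ?_⟩
  generalize s / 2 = m
  generalize t / 2 = n
  have e : ∑ᶠ ν ∈ boxSet m n, ∑ i ∈ Finset.Icc 1 m, ∑ j ∈ Finset.Icc 1 (ν.parts (i - 1)),
      fmsA s t i j = ∑ᶠ ν ∈ boxSet m n,
        boxStat m ((s : ℤ) * t + s + t) (-2 * t) (-2 * s) ν := by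
    refine finsum_mem_congr rfl fun ν _ => ?_
    unfold boxStat
    refine Finset.sum_congr rfl fun i _ => Finset.sum_congr rfl fun j _ => ?_
    unfold fmsA
    ring
  rw [e]
  have h := box_main m n ((s : ℤ) * t + s + t) (-2 * t) (-2 * s)
  have h1 := choose_prod m n
  have h2 := choose_prod n m
  rw [add_comm n m, Nat.choose_symm_add.symm] at h2
  have h3 : (3 : ℤ) ≠ 0 := by norm_num
  apply mul_left_cancel₀ h3
  linear_combination h + 2 * t * h1 + 2 * s * h2
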